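/- Let s : {0,1,...,5} → ℤ be strictly increasing with −2 ≤ s(i) ≤ 5 for all i, and set τ = Σ_{i=0}^{5} (s(i) + 2 − i). Let j ∈ {0,...,5} be such that s(j) − 1 ≠ −3 and s(j) − 1 ≠ s(i) for every i ∈ {0,...,5}. Then for every integer t with 2 ≤ t ≤ 5, there exists no i ∈ {0,...,5} with s(i) + s(j) = t if and only if at least one of the following holds: (1) τ = 10 − t; (2) t = 5, j = 0 and s(0) = −1; (3) t = 2, j = 5 and s(5) = 5; (4) 2·s(j) = t + 1. -/

import Mathlib

/-- **Lemma 4.14 (lem:depart).** Let `s : Fin 6 → ℤ` be strictly increasing with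
`-2 ≤ s i ≤ 5` for all `i`, and set `τ = ∑ i, (s i + 2 - i)`.  Let `j` be such that
`s j - 1 ≠ -3` and `s j - 1 ≠ s i` for every `i`.  Then for every integer `t` with
`2 ≤ t ≤ 5`, there is no `i` with `s i + s j = t` if and only if
(1) `τ = 10 - t`; or (2) `t = 5`, `j = 0`, `s 0 = -1`; or (3) `t = 2`, `j = 5`,
`s 5 = 5`; or (4) `2 * s j = t + 1`. -/
theorem stmt_0 (s : Fin 6 → ℤ) (hs : StrictMono s)
    (hlow : ∀ i, -2 ≤ s i) (hhigh : ∀ i, s i ≤ 5)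
    (j : Fin 6) (hj1 : s j - 1 ≠ -3) (hj2 : ∀ i, s j - 1 ≠ s i)
    (t : ℤ) (ht2 : 2 ≤ t) (ht5 : t ≤ 5) :
    (¬ ∃ i : Fin 6, s i + s j = t) ↔
      ((∑ i : Fin 6, (s i + 2 - ((i : ℕ) : ℤ))) = 10 - t ∨
        (t = 5 ∧ j = 0 ∧ s 0 = -1) ∨
        (t = 2 ∧ j = 5 ∧ s 5 = 5) ∨
        2 * s j = t + 1) := by
  have h01 : s 0 < s 1 := hs (by decide)
  have h12 : s 1 < s 2 := hs (by decide)
  have h23 : s 2 < s 3 := hs (by decide)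
  have h34 : s 3 < s 4 := hs (by decide)
  have h45 : s 4 < s 5 := hs (by decide)
  have h0 := hlow 0
  have h5 := hhigh 5
  have hs0 : s 0 = -2 ∨ s 0 = -1 ∨ s 0 = 0 := by omega
  have hs1 : s 1 = -1 ∨ s 1 = 0 ∨ s 1 = 1 := by omega
  have hs2 : s 2 = 0 ∨ s 2 = 1 ∨ s 2 = 2 := by omega
  have hs3 : s 3 = 1 ∨ s 3 = 2 ∨ s 3 = 3 := by omega
  have hs4 : s 4 = 2 ∨ s 4 = 3 ∨ s 4 = 4 := by omega
  have hs5 : s 5 = 3 ∨ s 5 = 4 ∨ s 5 = 5 := by omega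
  clear hs hlow hhigh
  simp only [Fin.exists_fin_succ, Fin.forall_fin_succ, Fin.sum_univ_six] at hj2 ⊢
  rcases hs0 with e0 | e0 | e0 <;> rcases hs1 with e1 | e1 | e1 <;> try omega
  all_goals rcases hs2 with e2 | e2 | e2 <;> try omega
  all_goals rcases hs3 with e3 | e3 | e3 <;> try omega
  all_goals rcases hs4 with e4 | e4 | e4 <;> try omega
  all_goals rcases hs5 with e5 | e5 | e5 <;> try omega
  all_goals fin_cases j <;> simp [e0, e1, e2, e3, e4, e5] at hj1 hj2 ⊢ <;> omega
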